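/- Let q be a prime number with q ≡ 3 (mod 8). Let K = ℚ(√2, √q), and let ε₂, ε_q, ε_{2q} denote the images in the ring of integers of K of the fundamental units (greater than 1 under a real embedding with √2, √q > 0) of ℚ(√2), ℚ(√q), ℚ(√(2q)) respectively. Then ε_q and ε_{2q} are squares in the ring of integers of K, and for any units u, v with u² = ε_q and v² = ε_{2q}, the unit group of the ring of integers of K is generated by −1, ε₂, u and v; that is, {ε₂, √ε_q, √ε_{2q}} is a fundamental system of units of K. -/

import Mathlib

/-- The real quadratic field `ℚ(√d)` as a subfield of `ℝ`. -/
noncomputable def QF (d : ℕ) : IntermediateField ℚ ℝ :=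
  IntermediateField.adjoin ℚ {Real.sqrt d}

/-- The real value (under the inclusion in `ℝ`, where all square roots are
positive) of a unit of the ring of integers of a subfield `K` of `ℝ`. -/
noncomputable def uval {K : IntermediateField ℚ ℝ}
    (u : (integralClosure ℤ K)ˣ) : ℝ :=
  (((u : integralClosure ℤ K) : K) : ℝ)

/-- `t` is (the real value of) the fundamental unit of `ℚ(√d)`: a unit of the
ring of integers which is `> 1` and which generates the full unit group
together with `-1`. -/
def IsFundUnit (d : ℕ) (t : ℝ) : Prop :=
  ∃ ε : (integralClosure ℤ (QF d))ˣ,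
    uval ε = t ∧ 1 < t ∧
    ∀ u : (integralClosure ℤ (QF d))ˣ, ∃ n : ℤ, u = ε ^ n ∨ u = -(ε ^ n)

/-- The real multiquadratic field `ℚ(√a, √b)` as a subfield of `ℝ`. -/
noncomputable def K2 (a b : ℕ) : IntermediateField ℚ ℝ :=
  IntermediateField.adjoin ℚ {Real.sqrt a, Real.sqrt b}

/-- Two coprime positive integers whose product is a prime times a square are, in some order,
a square and the prime times a square. -/
theorem Int.exists_sq_prime_mul_sq_of_mul_eq {m n z : ℤ} {p : ℕ} (hp : p.Prime) (hm : 0 < m)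
    (hn : 0 < n) (hmn : IsCoprime m n) (h : m * n = p * z ^ 2) :
    ∃ a b : ℤ, (m = a ^ 2 ∧ n = p * b ^ 2) ∨ (m = p * a ^ 2 ∧ n = b ^ 2) := by
  have of_dvd : ∀ {m n : ℤ}, 0 < m → 0 < n → IsCoprime m n → m * n = p * z ^ 2 → (p : ℤ) ∣ m →
      ∃ a b : ℤ, m = p * a ^ 2 ∧ n = b ^ 2 := by
    rintro m n hm hn hmn h ⟨k, rfl⟩
    have hp0 : (0 : ℤ) < p := by exact_mod_cast hp.pos
    have hk : 0 < k := pos_of_mul_pos_right hm hp0.le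
    have hkn : IsCoprime k n := hmn.of_mul_left_right
    have hz : k * n = z ^ 2 := mul_left_cancel₀ hp0.ne' (by rw [← h]; ring)
    obtain ⟨a, ha⟩ := Int.sq_of_gcd_eq_one (Int.isCoprime_iff_gcd_eq_one.mp hkn) hz
    obtain ⟨b, hb⟩ := Int.sq_of_gcd_eq_one (Int.isCoprime_iff_gcd_eq_one.mp hkn.symm)
      ((mul_comm _ _).trans hz)
    have ha' : k = a ^ 2 := ha.resolve_right fun h' ↦ by nlinarith [sq_nonneg a]
    have hb' : n = b ^ 2 := hb.resolve_right fun h' ↦ by nlinarith [sq_nonneg b]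
    exact ⟨a, b, by rw [ha'], hb'⟩
  rcases (Nat.prime_iff_prime_int.mp hp).dvd_or_dvd (Dvd.intro _ h.symm) with hd | hd
  · obtain ⟨a, b, hab⟩ := of_dvd hm hn hmn h hd
    exact ⟨a, b, .inr hab⟩
  · obtain ⟨a, b, hab⟩ := of_dvd hn hm hmn.symm ((mul_comm _ _).trans h) hd
    exact ⟨b, a, .inl hab.symm⟩

theorem sq_add_one_ne_mul_of_mod_eight_eq_three {q : ℕ} [Fact q.Prime] (hq : q % 8 = 3) (a c : ℤ) :
    a ^ 2 + 1 ≠ q * c := by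
  intro h
  have h' := congrArg (Int.cast : ℤ → ZMod q) h
  push_cast at h'
  rw [ZMod.natCast_self, zero_mul] at h'
  exact ZMod.mod_four_ne_three_of_sq_eq_neg_one (eq_neg_of_add_eq_zero_left h') (by omega)

theorem sq_sub_two_ne_mul_of_mod_eight_eq_three {q : ℕ} [Fact q.Prime] (hq : q % 8 = 3) (a c : ℤ) :
    a ^ 2 - 2 ≠ q * c := by
  intro h
  have h' := congrArg (Int.cast : ℤ → ZMod q) h
  push_cast at h'
  rw [ZMod.natCast_self, zero_mul, sub_eq_zero] at h'
  have := (ZMod.exists_sq_eq_two_iff (p := q) (by omega)).mp ⟨a, by rw [← h', sq]⟩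
  omega

theorem exists_sq_sub_mul_sq_eq_neg_two {q : ℕ} [hp : Fact q.Prime] (hq : q % 8 = 3) :
    ∃ a b : ℤ, a ^ 2 - q * b ^ 2 = -2 := by
  have hqp := hp.out
  have hsq : ¬ IsSquare (q : ℤ) := by
    rw [Int.isSquare_natCast_iff]; exact hqp.prime.not_isSquare
  obtain ⟨s, hx1, -, hmin⟩ := Pell.IsFundamental.exists_of_not_isSquare
    (by exact_mod_cast hqp.pos) hsq
  have hs := s.prop
  generalize s.y = y at hs
  generalize s.x = x at hs hx1 hmin
  rcases Int.even_or_odd' x with ⟨k, rfl | rfl⟩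
  · have hc : IsCoprime (2 * k - 1) (2 * k + 1) := ⟨-(k + 1), k, by ring⟩
    obtain ⟨a, b, ⟨h1, h2⟩ | ⟨h1, h2⟩⟩ := Int.exists_sq_prime_mul_sq_of_mul_eq hqp (by omega)
      (by omega) hc (z := y) (by linear_combination hs)
    · exact ⟨a, b, by linear_combination h2 - h1⟩
    · exact (sq_sub_two_ne_mul_of_mod_eight_eq_three hq b (a ^ 2)
        (by linear_combination h1 - h2)).elim
  · have hy : Even y := by
      by_contra hy
      have hq' : Odd (q : ℤ) := by exact_mod_cast (Nat.odd_iff.mpr (by omega) : Odd q)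
      have := hq'.mul ((Int.not_even_iff_odd.mp hy).pow (n := 2))
      rw [← Int.not_even_iff_odd] at this
      exact this ⟨2 * k * (k + 1), by linear_combination -hs⟩
    obtain ⟨z, rfl⟩ := hy
    obtain ⟨a, b, ⟨h1, h2⟩ | ⟨h1, h2⟩⟩ := Int.exists_sq_prime_mul_sq_of_mul_eq hqp
      (m := k) (n := k + 1) (z := z) (by omega) (by omega) ⟨-1, 1, by ring⟩
      (by linarith)
    · exact (sq_add_one_ne_mul_of_mod_eight_eq_three hq a (b ^ 2)
        (by linear_combination h2 - h1)).elim
    · have hb : 1 < |b| := by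
        by_contra! hb
        have := sq_abs b
        nlinarith [abs_nonneg b]
      have := hmin (b := .mk |b| a (by rw [sq_abs]; linear_combination h1 - h2)) (by simpa using hb)
      have := sq_abs b
      simp only [Pell.Solution₁.x_mk] at *
      nlinarith

theorem exists_two_mul_sq_sub_mul_sq_eq_neg_one {q : ℕ} [hp : Fact q.Prime] (hq : q % 8 = 3) :
    ∃ a b : ℤ, 2 * a ^ 2 - q * b ^ 2 = -1 := by
  have hqp := hp.out
  have hsq : ¬ IsSquare (2 * q : ℤ) := by
    rintro ⟨r, hr⟩
    obtain ⟨k, rfl | rfl⟩ := Int.even_or_odd' r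
    · ring_nf at hr
      omega
    · ring_nf at hr
      omega
  have hq0 : (0 : ℤ) < q := by exact_mod_cast hqp.pos
  obtain ⟨s, hx1, -, hmin⟩ := Pell.IsFundamental.exists_of_not_isSquare (by omega) hsq
  have hs := s.prop
  generalize s.y = y at hs
  generalize s.x = x at hs hx1 hmin
  obtain ⟨m, rfl⟩ : Odd x := by
    by_contra hx
    obtain ⟨k, rfl⟩ := Int.not_odd_iff_even.mp hx
    ring_nf at hs
    omega
  have hy : Even y := by
    by_contra hy
    have hq' : Odd (q : ℤ) := by exact_mod_cast (Nat.odd_iff.mpr (by omega) : Odd q)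
    have := hq'.mul ((Int.not_even_iff_odd.mp hy).pow (n := 2))
    rw [← Int.not_even_iff_odd] at this
    exact this ⟨m * (m + 1), by linarith⟩
  obtain ⟨z, rfl⟩ := hy
  rcases Int.even_or_odd' m with ⟨k, rfl | rfl⟩
  · obtain ⟨a, b, ⟨h1, h2⟩ | ⟨h1, h2⟩⟩ := Int.exists_sq_prime_mul_sq_of_mul_eq hqp
      (m := k) (n := 2 * k + 1) (z := z) (by omega) (by omega) ⟨-2, 1, by ring⟩
      (by linarith)
    · exact ⟨a, b, by linear_combination h2 - 2 * h1⟩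
    · have hb : 1 < |b| := by
        by_contra! hb
        have := sq_abs b
        nlinarith [abs_nonneg b]
      have := hmin (b := .mk |b| a (by rw [sq_abs]; linear_combination 2 * h1 - h2))
        (by simpa using hb)
      have := sq_abs b
      simp only [Pell.Solution₁.x_mk] at *
      nlinarith
  · obtain ⟨a, b, ⟨h1, h2⟩ | ⟨h1, h2⟩⟩ := Int.exists_sq_prime_mul_sq_of_mul_eq hqp
      (m := 2 * k + 1) (n := k + 1) (z := z) (by omega) (by omega) ⟨-1, 2, by ring⟩
      (by linarith)
    · exact (sq_add_one_ne_mul_of_mod_eight_eq_three hq a (2 * b ^ 2)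
        (by linear_combination 2 * h2 - h1)).elim
    · exact (sq_sub_two_ne_mul_of_mod_eight_eq_three hq (2 * b) (2 * a ^ 2)
        (by linear_combination 2 * h1 - 4 * h2)).elim

/-- The unit group of the ring of integers of `K`, mapped to `ℝ`. -/
noncomputable def uvalHom (K : IntermediateField ℚ ℝ) : (integralClosure ℤ K)ˣ →* ℝ :=
  (algebraMap K ℝ : K →* ℝ).comp
    (((integralClosure ℤ K).val : integralClosure ℤ K →* K).comp (Units.coeHom _))

theorem uval_mul {K : IntermediateField ℚ ℝ} (u v : (integralClosure ℤ K)ˣ) :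
    uval (u * v) = uval u * uval v :=
  map_mul (uvalHom K) u v

theorem uval_zpow {K : IntermediateField ℚ ℝ} (u : (integralClosure ℤ K)ˣ) (n : ℤ) :
    uval (u ^ n) = uval u ^ n :=
  map_zpow (uvalHom K) u n

theorem uval_inv {K : IntermediateField ℚ ℝ} (u : (integralClosure ℤ K)ˣ) :
    uval u⁻¹ = (uval u)⁻¹ :=
  map_inv (uvalHom K) u

theorem uval_neg {K : IntermediateField ℚ ℝ} (u : (integralClosure ℤ K)ˣ) :
    uval (-u) = -uval u := rfl

theorem uval_injective {K : IntermediateField ℚ ℝ} :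
    Function.Injective (uval : (integralClosure ℤ K)ˣ → ℝ) :=
  fun _ _ h ↦ Units.ext (Subtype.ext (Subtype.ext h))

/-- A nonzero real algebraic integer whose inverse is also an algebraic integer. -/
def IsIntegralUnit (t : ℝ) : Prop :=
  t ≠ 0 ∧ IsIntegral ℤ t ∧ IsIntegral ℤ t⁻¹

namespace IsIntegralUnit

theorem of_mul_eq_one {s t : ℝ} (hs : IsIntegral ℤ s) (ht : IsIntegral ℤ t) (h : s * t = 1) :
    IsIntegralUnit s :=
  ⟨left_ne_zero_of_mul_eq_one h, hs, by rwa [inv_eq_of_mul_eq_one_right h]⟩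

theorem mul {s t : ℝ} (hs : IsIntegralUnit s) (ht : IsIntegralUnit t) : IsIntegralUnit (s * t) :=
  ⟨mul_ne_zero hs.1 ht.1, hs.2.1.mul ht.2.1, by rw [mul_inv]; exact hs.2.2.mul ht.2.2⟩

theorem of_sq {t : ℝ} (h : IsIntegralUnit (t ^ 2)) : IsIntegralUnit t :=
  ⟨fun h0 ↦ h.1 (by simp [h0]), .of_pow two_pos h.2.1,
    .of_pow two_pos (by rw [inv_pow]; exact h.2.2)⟩

theorem map {K : IntermediateField ℚ ℝ} (σ : K →+* ℝ) {x : K} (hx : IsIntegralUnit (x : ℝ)) :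
    IsIntegralUnit (σ x) := by
  have int {y : K} (hy : IsIntegral ℤ (y : ℝ)) : IsIntegral ℤ (σ y) :=
    map_isIntegral_int σ ((isIntegral_algebraMap_iff (algebraMap K ℝ).injective).mp hy)
  refine ⟨?_, int hx.2.1, ?_⟩
  · rw [Ne, map_eq_zero]
    exact fun h ↦ hx.1 (by simp [h])
  · rw [← map_inv₀]
    exact int (by simpa using hx.2.2)

theorem exists_uval_eq {K : IntermediateField ℚ ℝ} {t : ℝ} (ht : IsIntegralUnit t) (hK : t ∈ K) :
    ∃ u : (integralClosure ℤ K)ˣ, uval u = t := by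
  have int {y : K} (hy : IsIntegral ℤ (y : ℝ)) : y ∈ integralClosure ℤ K :=
    (isIntegral_algebraMap_iff (algebraMap K ℝ).injective).mp hy
  have h0 : (⟨t, hK⟩ : K) ≠ 0 := fun h ↦ ht.1 (congrArg Subtype.val h)
  exact ⟨⟨⟨⟨t, hK⟩, int ht.2.1⟩, ⟨⟨t, hK⟩⁻¹, int (by simpa using ht.2.2)⟩,
    Subtype.ext (mul_inv_cancel₀ h0), Subtype.ext (inv_mul_cancel₀ h0)⟩, rfl⟩

end IsIntegralUnit

theorem uval_mem {K : IntermediateField ℚ ℝ} (u : (integralClosure ℤ K)ˣ) : uval u ∈ K :=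
  ((u : integralClosure ℤ K) : K).2

theorem isIntegralUnit_uval {K : IntermediateField ℚ ℝ} (u : (integralClosure ℤ K)ˣ) :
    IsIntegralUnit (uval u) := by
  have int (v : (integralClosure ℤ K)ˣ) : IsIntegral ℤ (uval v) :=
    map_isIntegral_int (algebraMap K ℝ)
      (show IsIntegral ℤ ((v : integralClosure ℤ K) : K) from (v : integralClosure ℤ K).2)
  refine .of_mul_eq_one (int u) (int u⁻¹) ?_
  rw [← uval_mul, mul_inv_cancel]
  rfl

namespace IsFundUnit

variable {d : ℕ} {t : ℝ}

theorem one_lt (h : IsFundUnit d t) : 1 < t := by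
  obtain ⟨-, -, h, -⟩ := h
  exact h

theorem mem (h : IsFundUnit d t) : t ∈ QF d := by
  obtain ⟨ε, rfl, -⟩ := h
  exact uval_mem ε

theorem isIntegralUnit (h : IsFundUnit d t) : IsIntegralUnit t := by
  obtain ⟨ε, rfl, -⟩ := h
  exact isIntegralUnit_uval ε

theorem exists_zpow (h : IsFundUnit d t) {w : ℝ} (hw : IsIntegralUnit w) (hd : w ∈ QF d) :
    ∃ n : ℤ, w = t ^ n ∨ w = -t ^ n := by
  obtain ⟨ε, rfl, -, hε⟩ := h
  obtain ⟨u, rfl⟩ := hw.exists_uval_eq hd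
  obtain ⟨n, rfl | rfl⟩ := hε u
  · exact ⟨n, .inl (uval_zpow ε n)⟩
  · exact ⟨n, .inr (by rw [uval_neg, uval_zpow])⟩

theorem exists_abs_eq_zpow (h : IsFundUnit d t) {w : ℝ} (hw : IsIntegralUnit w) (hd : w ∈ QF d) :
    ∃ n : ℤ, |w| = t ^ n := by
  obtain ⟨n, hn⟩ := h.exists_zpow hw hd
  exact ⟨n, by rw [abs_eq (zpow_nonneg (one_pos.trans h.one_lt).le n)]; exact hn⟩

end IsFundUnit

theorem sqrt_mem_QF (d : ℕ) : √(d : ℝ) ∈ QF d :=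
  IntermediateField.mem_adjoin_simple_self ℚ _

theorem add_mul_sqrt_mem_QF (d : ℕ) (a b : ℚ) : a + b * √(d : ℝ) ∈ QF d :=
  add_mem (algebraMap_mem _ a) (mul_mem (algebraMap_mem _ b) (sqrt_mem_QF d))

theorem isIntegral_sqrt (d : ℕ) : IsIntegral ℤ √(d : ℝ) :=
  .of_pow two_pos (by rw [Real.sq_sqrt (Nat.cast_nonneg d)]; exact isIntegral_algebraMap (x := (d : ℤ)))

theorem isAlgebraic_sqrt (d : ℕ) : IsAlgebraic ℚ √(d : ℝ) :=
  ((isIntegral_sqrt d).tower_top (A := ℚ)).isAlgebraic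

theorem exists_coords_of_mem_K2 {p q : ℕ} {z : ℝ} (hz : z ∈ K2 p q) :
    ∃ a b c d : ℚ, z = a + b * √(p : ℝ) + c * √(q : ℝ) + d * (√(p : ℝ) * √(q : ℝ)) := by
  rw [K2, ← IntermediateField.mem_toSubalgebra,
    IntermediateField.adjoin_toSubalgebra_of_isAlgebraic (by
      rintro x (rfl | rfl) <;> exact isAlgebraic_sqrt _)] at hz
  induction hz using Algebra.adjoin_induction with
  | mem x hx =>
    rcases hx with rfl | rfl
    · exact ⟨0, 1, 0, 0, by simp⟩
    · exact ⟨0, 0, 1, 0, by simp⟩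
  | algebraMap r => exact ⟨r, 0, 0, 0, by simp⟩
  | add x y _ _ hx hy =>
    obtain ⟨a, b, c, d, rfl⟩ := hx
    obtain ⟨a', b', c', d', rfl⟩ := hy
    exact ⟨a + a', b + b', c + c', d + d', by push_cast; ring⟩
  | mul x y _ _ hx hy =>
    obtain ⟨a, b, c, d, rfl⟩ := hx
    obtain ⟨a', b', c', d', rfl⟩ := hy
    refine ⟨a * a' + p * b * b' + q * c * c' + p * q * d * d',
      a * b' + b * a' + q * (c * d' + d * c'), a * c' + c * a' + p * (b * d' + d * b'),
      a * d' + d * a' + b * c' + c * b', ?_⟩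
    have hp := Real.sq_sqrt (Nat.cast_nonneg (α := ℝ) p)
    have hq := Real.sq_sqrt (Nat.cast_nonneg (α := ℝ) q)
    push_cast
    linear_combination (b * b' + d * d' * √(q : ℝ) ^ 2 + (b * d' + d * b') * √(q : ℝ)) * hp +
      (c * c' + p * d * d' + (c * d' + d * c') * √(p : ℝ)) * hq

theorem exists_coords_of_mem_QF {q : ℕ} {z : ℝ} (hz : z ∈ QF q) :
    ∃ a b : ℚ, z = a + b * √(q : ℝ) := by
  rw [QF, ← IntermediateField.mem_toSubalgebra,
    IntermediateField.adjoin_simple_toSubalgebra_of_isAlgebraic (isAlgebraic_sqrt q)] at hz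
  induction hz using Algebra.adjoin_induction with
  | mem x hx =>
    rcases hx with rfl
    exact ⟨0, 1, by simp⟩
  | algebraMap r => exact ⟨r, 0, by simp⟩
  | add x y _ _ hx hy =>
    obtain ⟨a, b, rfl⟩ := hx
    obtain ⟨a', b', rfl⟩ := hy
    exact ⟨a + a', b + b', by push_cast; ring⟩
  | mul x y _ _ hx hy =>
    obtain ⟨a, b, rfl⟩ := hx
    obtain ⟨a', b', rfl⟩ := hy
    refine ⟨a * a' + q * b * b', a * b' + b * a', ?_⟩
    have hq := Real.sq_sqrt (Nat.cast_nonneg (α := ℝ) q)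
    push_cast
    linear_combination b * b' * hq

theorem sqrt_notMem_QF {p q : ℕ} (hp : Irrational √(p : ℝ)) (hq : Irrational √(q : ℝ))
    (hpq : Irrational (√(p : ℝ) * √(q : ℝ))) : √(p : ℝ) ∉ QF q := by
  intro h
  obtain ⟨a, b, hab⟩ := exists_coords_of_mem_QF h
  have hp2 := Real.sq_sqrt (Nat.cast_nonneg (α := ℝ) p)
  have hq2 := Real.sq_sqrt (Nat.cast_nonneg (α := ℝ) q)
  by_cases hb : b = 0
  · exact hp ⟨a, by simp [hab, hb]⟩
  by_cases ha : a = 0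
  · exact hpq ⟨b * q, by push_cast; rw [hab, ha]; push_cast; linear_combination -b * hq2⟩
  · have ha' : (a : ℝ) ≠ 0 := by exact_mod_cast ha
    have hb' : (b : ℝ) ≠ 0 := by exact_mod_cast hb
    refine hq ⟨(p - a ^ 2 - q * b ^ 2) / (2 * a * b), ?_⟩
    push_cast
    rw [div_eq_iff (by positivity)]
    rw [hab] at hp2
    linear_combination -hp2 + b ^ 2 * hq2

theorem K2_comm (p q : ℕ) : K2 p q = K2 q p := by
  rw [K2, K2, Set.pair_comm]

theorem QF_le_K2_left (p q : ℕ) : QF p ≤ K2 p q :=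
  IntermediateField.adjoin.mono _ _ _ (by simp)

theorem QF_le_K2_right (p q : ℕ) : QF q ≤ K2 p q :=
  IntermediateField.adjoin.mono _ _ _ (by simp)

theorem QF_mul_le_K2 (p q : ℕ) : QF (p * q) ≤ K2 p q := by
  rw [QF, IntermediateField.adjoin_simple_le_iff, Nat.cast_mul, Real.sqrt_mul (Nat.cast_nonneg p)]
  exact mul_mem (QF_le_K2_left p q (sqrt_mem_QF p)) (QF_le_K2_right p q (sqrt_mem_QF q))

open IntermediateField Polynomial in
/-- If `s ∉ F` and `s ^ 2 ∈ F` then there is an `F`-embedding of `F(s)` sending `s` to `-s`. -/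
theorem exists_algHom_gen_eq_neg (F : IntermediateField ℚ ℝ) {s : ℝ} (hs : s ∉ F)
    (hs2 : s ^ 2 ∈ F) : ∃ σ : F⟮s⟯ →ₐ[F] ℝ, σ (AdjoinSimple.gen F s) = -s := by
  have hirr : Irreducible (X ^ 2 - C (⟨s ^ 2, hs2⟩ : F)) := by
    refine X_pow_sub_C_irreducible_of_prime Nat.prime_two fun b hb ↦ hs ?_
    have hb' : (b : ℝ) ^ 2 = s ^ 2 := congrArg Subtype.val hb
    rcases sq_eq_sq_iff_eq_or_eq_neg.mp hb' with h | h
    · exact h ▸ b.2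
    · rw [eq_neg_iff_add_eq_zero, add_comm, ← eq_neg_iff_add_eq_zero] at h
      exact h ▸ neg_mem b.2
  have hmin : X ^ 2 - C (⟨s ^ 2, hs2⟩ : F) = minpoly F s :=
    minpoly.eq_of_irreducible_of_monic hirr
      (by rw [map_sub, map_pow, aeval_X, aeval_C]; exact sub_self _)
      (monic_X_pow_sub_C _ two_ne_zero)
  have hint : IsIntegral F s :=
    .of_pow two_pos (isIntegral_algebraMap (x := (⟨s ^ 2, hs2⟩ : F)))
  have hroot : aeval (-s) (minpoly F (adjoin.powerBasis hint).gen) = 0 := by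
    rw [adjoin.powerBasis_gen, minpoly_gen, ← hmin, map_sub, map_pow, aeval_X, aeval_C, neg_sq]
    exact sub_self _
  exact ⟨(adjoin.powerBasis hint).lift (-s) hroot, PowerBasis.lift_gen _ _ hroot⟩

open IntermediateField in
/-- The embedding of `ℚ(√p, √q)` that fixes `√q` and sends `√p` to `-√p`. -/
theorem exists_ringHom_K2_left {p q : ℕ} (hp : √(p : ℝ) ∉ QF q) :
    ∃ σ : K2 p q →+* ℝ, ∀ (x : K2 p q) (a b c d : ℚ),
      (x : ℝ) = a + b * √(p : ℝ) + c * √(q : ℝ) + d * (√(p : ℝ) * √(q : ℝ)) →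
      σ x = a - b * √(p : ℝ) + c * √(q : ℝ) - d * (√(p : ℝ) * √(q : ℝ)) := by
  obtain ⟨τ, hτ⟩ := exists_algHom_gen_eq_neg (QF q) hp
    (by rw [Real.sq_sqrt (Nat.cast_nonneg p)]; exact _root_.natCast_mem _ p)
  have hle : K2 p q ≤ ((QF q)⟮√(p : ℝ)⟯).restrictScalars ℚ := by
    rw [K2, adjoin_le_iff]
    rintro x (rfl | rfl)
    · exact mem_adjoin_simple_self (QF q) _
    · exact IntermediateField.algebraMap_mem ((QF q)⟮√(p : ℝ)⟯) (⟨_, sqrt_mem_QF q⟩ : QF q)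
  let ι : K2 p q →+* (QF q)⟮√(p : ℝ)⟯ := (inclusion hle).toRingHom
  refine ⟨(τ : (QF q)⟮√(p : ℝ)⟯ →+* ℝ).comp ι, fun x a b c d hx ↦ ?_⟩
  have hι : ι x = a + b * AdjoinSimple.gen (QF q) √(p : ℝ) +
      c * algebraMap (QF q) _ ⟨_, sqrt_mem_QF q⟩ +
      d * (AdjoinSimple.gen (QF q) √(p : ℝ) * algebraMap (QF q) _ ⟨_, sqrt_mem_QF q⟩) := by
    apply Subtype.ext
    change (x : ℝ) = _
    rw [hx]
    simp
  rw [RingHom.comp_apply, hι]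
  have hq : τ (algebraMap (QF q) _ ⟨_, sqrt_mem_QF q⟩) = √(q : ℝ) := τ.commutes _
  simp only [map_add, map_mul, RingHom.coe_coe, map_ratCast, hτ, hq]
  ring

/-- If some unit `w` of `L` has `w ^ 2 ∈ ℚ(√d)` but `w ∉ ℚ(√d)`, where `L` contains `ℚ(√d)`, then
the fundamental unit of `ℚ(√d)` is a square in `L`. -/
theorem IsFundUnit.exists_uval_sq_eq {d : ℕ} {t : ℝ} (h : IsFundUnit d t)
    {L : IntermediateField ℚ ℝ} (hL : QF d ≤ L) {w : ℝ} (hw : IsIntegralUnit w) (hwL : w ∈ L)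
    (hwd : w ∉ QF d) (hw2 : w ^ 2 ∈ QF d) :
    ∃ u : (integralClosure ℤ L)ˣ, uval u ^ 2 = t := by
  have ht : 0 < t := one_pos.trans h.one_lt
  obtain ⟨n, hn⟩ := h.exists_zpow (sq w ▸ hw.mul hw) hw2
  replace hn : w ^ 2 = t ^ n := hn.resolve_right fun h' ↦ by
    nlinarith [zpow_pos ht n, sq_nonneg w]
  obtain ⟨k, rfl | rfl⟩ := Int.even_or_odd' n
  · rw [mul_comm, zpow_mul, zpow_ofNat] at hn
    rcases sq_eq_sq_iff_eq_or_eq_neg.mp hn with rfl | rfl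
    · exact (hwd (zpow_mem h.mem k)).elim
    · exact (hwd (neg_mem (zpow_mem h.mem k))).elim
  · have hsq : (w / t ^ k) ^ 2 = t := by
      rw [div_pow, hn, zpow_add_one₀ ht.ne', mul_comm 2 k, zpow_mul, zpow_ofNat]
      exact mul_div_cancel_left₀ _ (by positivity)
    obtain ⟨u, hu⟩ := IsIntegralUnit.exists_uval_eq (K := L) (t := w / t ^ k)
      (.of_sq (by rw [hsq]; exact h.isIntegralUnit)) (div_mem hwL (hL (zpow_mem h.mem k)))
    exact ⟨u, by rw [hu, hsq]⟩

section

variable {q : ℕ} [hp : Fact q.Prime]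

theorem irrational_sqrt_two_mul_sqrt (hq : q ≠ 2) : Irrational (√((2 : ℕ) : ℝ) * √(q : ℝ)) := by
  rw [← Real.sqrt_mul (Nat.cast_nonneg 2), ← Nat.cast_mul, irrational_sqrt_natCast_iff]
  rintro ⟨r, hr⟩
  have h2 : 2 ∣ r := by
    rcases Nat.prime_two.dvd_mul.mp (Dvd.intro _ hr) with h | h <;> exact h
  obtain ⟨k, rfl⟩ := h2
  have : 2 ∣ q := ⟨k * k, by linarith⟩
  exact hq ((Nat.prime_dvd_prime_iff_eq Nat.prime_two hp.out).mp this).symm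

theorem sqrt_two_notMem_QF (hq : q ≠ 2) : √((2 : ℕ) : ℝ) ∉ QF q :=
  sqrt_notMem_QF Nat.prime_two.irrational_sqrt hp.out.irrational_sqrt
    (irrational_sqrt_two_mul_sqrt hq)

theorem sqrt_notMem_QF_two (hq : q ≠ 2) : √(q : ℝ) ∉ QF 2 :=
  sqrt_notMem_QF hp.out.irrational_sqrt Nat.prime_two.irrational_sqrt
    (by rw [mul_comm]; exact irrational_sqrt_two_mul_sqrt hq)

theorem sqrt_two_notMem_QF_two_mul (hq : q ≠ 2) : √((2 : ℕ) : ℝ) ∉ QF (2 * q) := by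
  have h2q : √((2 * q : ℕ) : ℝ) = √((2 : ℕ) : ℝ) * √(q : ℝ) := by
    rw [Nat.cast_mul, Real.sqrt_mul (Nat.cast_nonneg 2)]
  refine sqrt_notMem_QF Nat.prime_two.irrational_sqrt
    (by rw [h2q]; exact irrational_sqrt_two_mul_sqrt hq) ?_
  rw [h2q, ← mul_assoc, Real.mul_self_sqrt (Nat.cast_nonneg 2)]
  exact hp.out.irrational_sqrt.natCast_mul two_ne_zero

theorem exists_uval_sq_eq_of_isFundUnit (hq : q % 8 = 3) {t : ℝ} (h : IsFundUnit q t) :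
    ∃ u : (integralClosure ℤ (K2 2 q))ˣ, uval u ^ 2 = t := by
  obtain ⟨a, b, hab⟩ := exists_sq_sub_mul_sq_eq_neg_two hq
  replace hab : (a : ℝ) ^ 2 - q * b ^ 2 = -2 := by exact_mod_cast hab
  have h2 : √((2 : ℕ) : ℝ) ∉ QF q := sqrt_two_notMem_QF (by omega)
  have hs2 : √((2 : ℕ) : ℝ) ^ 2 = 2 := by simp
  have hsq : √(q : ℝ) ^ 2 = q := Real.sq_sqrt (Nat.cast_nonneg q)
  have hmem : √((2 : ℕ) : ℝ) ∈ K2 2 q := QF_le_K2_left 2 q (sqrt_mem_QF 2)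
  have hint : IsIntegral ℤ √(q : ℝ) := isIntegral_sqrt q
  have hz (n : ℤ) : IsIntegral ℤ (n : ℝ) := isIntegral_algebraMap (x := n)
  generalize √((2 : ℕ) : ℝ) = s at *
  have hs0 : s ≠ 0 := by rintro rfl; norm_num at hs2
  have hx : (a + b * √(q : ℝ) : ℝ) ∈ QF q := by simpa using add_mul_sqrt_mem_QF q a b
  have hw2 : ((a + b * √(q : ℝ)) / s) ^ 2 = (a ^ 2 + 1 + a * b * √(q : ℝ) : ℝ) := by
    rw [div_pow, hs2]
    linear_combination b ^ 2 / 2 * hsq - hab / 2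
  have hw0 : (a + b * √(q : ℝ) : ℝ) ≠ 0 := by
    intro h0
    have : (a + b * √(q : ℝ)) * (a - b * √(q : ℝ)) = (-2 : ℝ) := by
      linear_combination hab - b ^ 2 * hsq
    rw [h0] at this
    norm_num at this
  refine h.exists_uval_sq_eq (w := (a + b * √(q : ℝ)) / s) (QF_le_K2_right 2 q) (.of_sq ?_)
    (div_mem (QF_le_K2_right 2 q hx) hmem) (fun hw ↦ h2 ?_) ?_
  · rw [hw2]
    refine .of_mul_eq_one (t := a ^ 2 + 1 - a * b * √(q : ℝ)) ?_ ?_ ?_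
    · exact (((hz a).pow 2).add isIntegral_one).add (((hz a).mul (hz b)).mul hint)
    · exact (((hz a).pow 2).add isIntegral_one).sub (((hz a).mul (hz b)).mul hint)
    · linear_combination a ^ 2 * hab - a ^ 2 * b ^ 2 * hsq
  · have := div_mem hx hw
    rwa [div_div_cancel₀ hw0] at this
  · rw [div_pow, hs2]
    exact div_mem (pow_mem hx 2) (ofNat_mem _ 2)

theorem exists_uval_sq_eq_of_isFundUnit_two_mul (hq : q % 8 = 3) {t : ℝ}
    (h : IsFundUnit (2 * q) t) :
    ∃ u : (integralClosure ℤ (K2 2 q))ˣ, uval u ^ 2 = t := by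
  obtain ⟨a, b, hab⟩ := exists_two_mul_sq_sub_mul_sq_eq_neg_one hq
  replace hab : 2 * (a : ℝ) ^ 2 - q * b ^ 2 = -1 := by exact_mod_cast hab
  have h2 : √((2 : ℕ) : ℝ) ∉ QF (2 * q) := sqrt_two_notMem_QF_two_mul (by omega)
  have hs2 : √((2 : ℕ) : ℝ) ^ 2 = 2 := by simp
  have hsq : √(q : ℝ) ^ 2 = q := Real.sq_sqrt (Nat.cast_nonneg q)
  have hmem : √((2 : ℕ) : ℝ) ∈ K2 2 q := QF_le_K2_left 2 q (sqrt_mem_QF 2)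
  have hqmem : √(q : ℝ) ∈ K2 2 q := QF_le_K2_right 2 q (sqrt_mem_QF q)
  have hint : IsIntegral ℤ √(q : ℝ) := isIntegral_sqrt q
  have hint2 : IsIntegral ℤ √((2 : ℕ) : ℝ) := isIntegral_sqrt 2
  have hz (n : ℤ) : IsIntegral ℤ (n : ℝ) := isIntegral_algebraMap (x := n)
  have hx := add_mul_sqrt_mem_QF (2 * q) (2 * a) b
  rw [Nat.cast_mul, Real.sqrt_mul (Nat.cast_nonneg 2)] at hx
  push_cast at hx
  generalize √((2 : ℕ) : ℝ) = s at *
  have hs0 : s ≠ 0 := by rintro rfl; norm_num at hs2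
  have hza (c : ℤ) : (c : ℝ) ∈ K2 2 q := intCast_mem _ c
  have hw : IsIntegralUnit (a * s + b * √(q : ℝ)) :=
    .of_mul_eq_one (t := b * √(q : ℝ) - a * s) (((hz a).mul hint2).add ((hz b).mul hint))
      (((hz b).mul hint).sub ((hz a).mul hint2))
      (by linear_combination b ^ 2 * hsq - a ^ 2 * hs2 - hab)
  have hsw : s * (a * s + b * √(q : ℝ)) = 2 * a + b * (s * √(q : ℝ)) := by
    linear_combination a * hs2
  rw [← hsw] at hx
  refine h.exists_uval_sq_eq (QF_mul_le_K2 2 q) hw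
    (add_mem (mul_mem (hza a) hmem) (mul_mem (hza b) hqmem)) (fun hwd ↦ h2 ?_) ?_
  · have := div_mem hx hwd
    rwa [mul_div_cancel_right₀ _ hw.1] at this
  · have := div_mem (pow_mem hx 2) (ofNat_mem (QF (2 * q)) 2)
    rwa [mul_pow, hs2, mul_div_cancel_left₀ _ two_ne_zero] at this

theorem uval_sq_ne_of_isFundUnit_two (hq : q ≠ 2) {t : ℝ} (h : IsFundUnit 2 t)
    (u : (integralClosure ℤ (K2 2 q))ˣ) : uval u ^ 2 ≠ t := by
  obtain ⟨σ, hσ⟩ := exists_ringHom_K2_left (sqrt_two_notMem_QF hq)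
  intro hu
  have hs2 : √((2 : ℕ) : ℝ) ^ 2 = 2 := by simp
  have hs : 0 ≤ √((2 : ℕ) : ℝ) := Real.sqrt_nonneg _
  have hmem : (1 + √((2 : ℕ) : ℝ)) ∈ QF 2 := by simpa using add_mul_sqrt_mem_QF 2 1 1
  have hunit : IsIntegralUnit (1 + √((2 : ℕ) : ℝ)) :=
    .of_mul_eq_one (t := √((2 : ℕ) : ℝ) - 1) (isIntegral_one.add (isIntegral_sqrt 2))
      ((isIntegral_sqrt 2).sub isIntegral_one) (by linear_combination hs2)
  obtain ⟨n, hn⟩ := h.exists_zpow hunit hmem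
  replace hn := hn.resolve_right fun h' ↦ by
    linarith [zpow_pos (one_pos.trans h.one_lt) n]
  have hx : (⟨_, QF_le_K2_left 2 q hmem⟩ : K2 2 q) =
      (((u : integralClosure ℤ (K2 2 q)) : K2 2 q) ^ n) ^ 2 := by
    apply Subtype.ext
    change 1 + √((2 : ℕ) : ℝ) = (uval u ^ n) ^ 2
    rw [hn, ← hu, ← zpow_natCast, ← zpow_natCast, ← zpow_mul, ← zpow_mul, mul_comm]
  have hσx : σ ⟨_, QF_le_K2_left 2 q hmem⟩ = 1 - √((2 : ℕ) : ℝ) := by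
    simpa using hσ ⟨_, QF_le_K2_left 2 q hmem⟩ 1 1 0 0 (by simp)
  rw [hx, map_pow] at hσx
  nlinarith [sq_nonneg (σ (((u : integralClosure ℤ (K2 2 q)) : K2 2 q) ^ n))]

/-- The square of a unit of `ℚ(√2, √q)` is a product of powers of the fundamental units of the
three quadratic subfields. -/
theorem exists_uval_sq_eq_zpow (hq : q ≠ 2) {e₂ e₁ e₃ : ℝ} (h₂ : IsFundUnit 2 e₂)
    (h₁ : IsFundUnit q e₁) (h₃ : IsFundUnit (2 * q) e₃) (u : (integralClosure ℤ (K2 2 q))ˣ) :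
    ∃ l m n : ℤ, uval u ^ 2 = e₂ ^ l * e₁ ^ m * e₃ ^ n := by
  obtain ⟨σ, hσ⟩ := exists_ringHom_K2_left (sqrt_two_notMem_QF hq)
  obtain ⟨τ, hτ⟩ := exists_ringHom_K2_left (sqrt_notMem_QF_two hq)
  have hu := isIntegralUnit_uval u
  obtain ⟨a, b, c, d, hx⟩ := exists_coords_of_mem_K2 (uval_mem u)
  have hu' : uval u ∈ K2 q 2 := K2_comm 2 q ▸ uval_mem u
  have hσu : IsIntegralUnit (σ ⟨uval u, uval_mem u⟩) := .map σ hu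
  have hτu : IsIntegralUnit (τ ⟨uval u, hu'⟩) := .map τ hu
  have hσx := hσ ⟨uval u, uval_mem u⟩ a b c d hx
  have hτx := hτ ⟨uval u, hu'⟩ a c b d (hx.trans (by ring))
  generalize σ ⟨uval u, uval_mem u⟩ = y at hσu hσx
  generalize τ ⟨uval u, hu'⟩ = z at hτu hτx
  clear hσ hτ
  have hs2 : √((2 : ℕ) : ℝ) ^ 2 = 2 := by simp
  have hsq : √(q : ℝ) ^ 2 = q := Real.sq_sqrt (Nat.cast_nonneg q)
  have hs2q : √((2 * q : ℕ) : ℝ) = √((2 : ℕ) : ℝ) * √(q : ℝ) := by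
    rw [Nat.cast_mul, Real.sqrt_mul (Nat.cast_nonneg 2)]
  have mem₂ := add_mul_sqrt_mem_QF 2 (a ^ 2 + 2 * b ^ 2 - q * c ^ 2 - 2 * q * d ^ 2)
    (2 * a * b - 2 * q * c * d)
  have mem₁ := add_mul_sqrt_mem_QF q (a ^ 2 + q * c ^ 2 - 2 * b ^ 2 - 2 * q * d ^ 2)
    (2 * a * c - 4 * b * d)
  have mem₃ := add_mul_sqrt_mem_QF (2 * q) (a ^ 2 + 2 * q * d ^ 2 - 2 * b ^ 2 - q * c ^ 2)
    (2 * b * c - 2 * a * d)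
  rw [hs2q] at mem₃
  generalize √((2 : ℕ) : ℝ) = s at *
  obtain ⟨l, hl⟩ := h₂.exists_abs_eq_zpow (hu.mul hτu) (by
    convert! mem₂ using 1
    rw [hx, hτx]
    push_cast
    linear_combination (b ^ 2 - d ^ 2 * √(q : ℝ) ^ 2) * hs2 -
      (c ^ 2 + 2 * c * d * s + 2 * d ^ 2) * hsq)
  obtain ⟨m, hm⟩ := h₁.exists_abs_eq_zpow (hu.mul hσu) (by
    convert! mem₁ using 1
    rw [hx, hσx]
    push_cast
    linear_combination (c ^ 2 - d ^ 2 * s ^ 2) * hsq -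
      (b ^ 2 + 2 * b * d * √(q : ℝ) + d ^ 2 * q) * hs2)
  obtain ⟨n, hn⟩ := h₃.exists_abs_eq_zpow (hσu.mul hτu) (by
    convert! mem₃ using 1
    rw [hσx, hτx]
    push_cast
    linear_combination (d ^ 2 * √(q : ℝ) ^ 2 - b ^ 2) * hs2 + (2 * d ^ 2 - c ^ 2) * hsq)
  refine ⟨l, m, -n, ?_⟩
  have hσ0 := abs_pos.mpr hσu.1
  have hτ0 := abs_pos.mpr hτu.1
  rw [zpow_neg, ← hl, ← hm, ← hn, abs_mul, abs_mul, abs_mul, ← sq_abs]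
  field_simp

end

theorem fsu_Qsqrt2_sqrtq
    (q : ℕ) [Fact (Nat.Prime q)] (hq : q % 8 = 3)
    (e2 eq' e2q : ℝ)
    (he2 : IsFundUnit 2 e2) (heq : IsFundUnit q eq')
    (he2q : IsFundUnit (2 * q) e2q) :
    (∃ E2 : (integralClosure ℤ (K2 2 q))ˣ, uval E2 = e2) ∧
    (∃ U : (integralClosure ℤ (K2 2 q))ˣ, uval U ^ 2 = eq') ∧
    (∃ V : (integralClosure ℤ (K2 2 q))ˣ, uval V ^ 2 = e2q) ∧
    ∀ E2 U V : (integralClosure ℤ (K2 2 q))ˣ,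
      uval E2 = e2 → uval U ^ 2 = eq' → uval V ^ 2 = e2q →
      Subgroup.closure {(-1 : (integralClosure ℤ (K2 2 q))ˣ), E2, U, V} = ⊤ := by
  refine ⟨he2.isIntegralUnit.exists_uval_eq (QF_le_K2_left 2 q he2.mem),
    exists_uval_sq_eq_of_isFundUnit hq heq, exists_uval_sq_eq_of_isFundUnit_two_mul hq he2q,
    fun E U V hE hU hV ↦ ?_⟩
  have hq2 : q ≠ 2 := by omega
  set S := Subgroup.closure {(-1 : (integralClosure ℤ (K2 2 q))ˣ), E, U, V}
  have hneg : -1 ∈ S := Subgroup.subset_closure (by simp)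
  have hES : E ∈ S := Subgroup.subset_closure (by simp)
  have hUS : U ∈ S := Subgroup.subset_closure (by simp)
  have hVS : V ∈ S := Subgroup.subset_closure (by simp)
  refine (Subgroup.eq_top_iff' S).mpr fun u ↦ ?_
  obtain ⟨l, m, n, h⟩ := exists_uval_sq_eq_zpow hq2 he2 heq he2q u
  replace h : u ^ (2 : ℤ) = E ^ l * (U ^ m * V ^ n) ^ (2 : ℤ) := by
    apply uval_injective
    simp only [uval_mul, uval_zpow, mul_zpow]
    rw [zpow_ofNat, h, hE, ← hU, ← hV, mul_assoc]
    simp only [← zpow_natCast, ← zpow_mul, mul_comm, Nat.cast_ofNat]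
  obtain ⟨w, rfl⟩ : ∃ w, u = w * (U ^ m * V ^ n) := ⟨_, (div_mul_cancel u _).symm⟩
  refine mul_mem ?_ (mul_mem (zpow_mem hUS m) (zpow_mem hVS n))
  rw [mul_zpow, mul_left_inj] at h
  obtain ⟨k, rfl | rfl⟩ := Int.even_or_odd' l
  · have h' : uval w ^ 2 = uval (E ^ k) ^ 2 := by
      rw [← zpow_ofNat, ← uval_zpow, h, ← zpow_ofNat, ← uval_zpow, ← zpow_mul, mul_comm]
    rcases sq_eq_sq_iff_eq_or_eq_neg.mp h' with h' | h'
    · rw [uval_injective h']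
      exact zpow_mem hES k
    · rw [← uval_neg] at h'
      rw [uval_injective h', ← neg_one_mul]
      exact mul_mem hneg (zpow_mem hES k)
  · refine (uval_sq_ne_of_isFundUnit_two hq2 he2 (w * E ^ (-k)) ?_).elim
    rw [← hE, ← zpow_ofNat, ← uval_zpow, mul_zpow, h, ← zpow_mul, ← zpow_add]
    ring_nf
    rw [zpow_one]
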